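/- Let p be a prime and u ≥ 0 an integer, and let G be a finite abelian p-group. For each n, let μ_n be the Haar probability measure on (n+u) × n matrices over ℤ_p. Then the limit as n → ∞ of the μ_n-probability that the torsion submodule (coker M)[p^∞] of the cokernel of a random matrix M is isomorphic to G equals (∏_{i=1}^{∞} (1 − p^{−i−u})) / (|G|^u · |Aut G|). -/

import Mathlib

open MeasureTheory Filter

noncomputable instance (p : ℕ) [Fact p.Prime] : MeasurableSpace ℤ_[p] := borel _
instance (p : ℕ) [Fact p.Prime] : BorelSpace ℤ_[p] := ⟨rfl⟩

instance (p : ℕ) [Fact p.Prime] (m n : ℕ) :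
    CompactSpace (Matrix (Fin m) (Fin n) ℤ_[p]) :=
  (inferInstance : CompactSpace (Fin m → Fin n → ℤ_[p]))

noncomputable instance (p : ℕ) [Fact p.Prime] (m n : ℕ) :
    MeasurableSpace (Matrix (Fin m) (Fin n) ℤ_[p]) :=
  (inferInstance : MeasurableSpace (Fin m → Fin n → ℤ_[p]))

instance (p : ℕ) [Fact p.Prime] (m n : ℕ) :
    BorelSpace (Matrix (Fin m) (Fin n) ℤ_[p]) :=
  (inferInstance : BorelSpace (Fin m → Fin n → ℤ_[p]))

/-- The Haar probability measure on the compact additive group of `m × n` matrices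
over the `p`-adic integers, normalized so that the total space has measure `1`. -/
noncomputable def padicMatrixHaar (p : ℕ) [Fact p.Prime] (m n : ℕ) :
    Measure (Matrix (Fin m) (Fin n) ℤ_[p]) :=
  Measure.addHaarMeasure ⟨⟨Set.univ, isCompact_univ⟩, by
    rw [interior_univ]; exact Set.univ_nonempty⟩

/-- The `p^∞`-torsion submodule of a `ℤ_p`-module: the elements annihilated by
some power of `p`. -/
def pPrimaryTorsion (p : ℕ) [Fact p.Prime] (M : Type*) [AddCommGroup M]
    [Module ℤ_[p] M] : Submodule ℤ_[p] M where
  carrier := {x | ∃ k : ℕ, (p : ℤ_[p]) ^ k • x = 0}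
  zero_mem' := ⟨0, smul_zero _⟩
  add_mem' := by
    rintro a b ⟨k, hk⟩ ⟨l, hl⟩
    refine ⟨k + l, ?_⟩
    have ha : (p : ℤ_[p]) ^ (k + l) • a = 0 := by
      rw [pow_add, mul_comm, mul_smul, hk, smul_zero]
    have hb : (p : ℤ_[p]) ^ (k + l) • b = 0 := by
      rw [pow_add, mul_smul, hl, smul_zero]
    rw [smul_add, ha, hb, add_zero]
  smul_mem' := by
    rintro c x ⟨k, hk⟩
    exact ⟨k, by rw [smul_comm, hk, smul_zero]⟩

section SmithForm

variable {p : ℕ} [Fact p.Prime]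

theorem PadicInt.exists_dvd_pow {a : ℤ_[p]} (ha : a ≠ 0) : ∃ k : ℕ, a ∣ (p : ℤ_[p]) ^ k := by
  refine ⟨a.valuation, ?_⟩
  conv_lhs => rw [PadicInt.unitCoeff_spec ha]
  exact (Units.mul_left_dvd).2 dvd_rfl

theorem Module.Basis.SmithNormalForm.mem_iff {R M ι : Type*} [CommRing R] [AddCommGroup M]
    [Module R M] [Fintype ι] {n : ℕ} {N : Submodule R M} (s : Module.Basis.SmithNormalForm N ι n)
    (x : M) :
    x ∈ N ↔ (∀ j ∉ Set.range s.f, s.bM.repr x j = 0) ∧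
      ∀ i, s.a i ∣ s.bM.repr x (s.f i) := by
  classical
  constructor
  · intro hx
    refine ⟨fun j hj => s.repr_eq_zero_of_notMem_range ⟨x, hx⟩ hj, fun i => ?_⟩
    rw [s.repr_apply_embedding_eq_repr_smul (m := ⟨x, hx⟩), map_smul]
    exact ⟨_, rfl⟩
  · rintro ⟨h0, h⟩
    rw [← s.bM.sum_repr x]
    refine Submodule.sum_mem _ fun j _ => ?_
    by_cases hj : j ∈ Set.range s.f
    · obtain ⟨i, rfl⟩ := hj
      obtain ⟨c, hc⟩ := h i
      rw [hc, mul_comm, mul_smul, ← s.snf]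
      exact N.smul_mem _ (s.bN i).2
    · rw [h0 j hj, zero_smul]
      exact N.zero_mem

/-- The torsion of a cokernel is the product of the cyclic modules given by the
invariant factors. -/
theorem nonempty_pPrimaryTorsion_quotient_equiv {M ι : Type*} [AddCommGroup M]
    [Module ℤ_[p] M] [Fintype ι] {n : ℕ} {N : Submodule ℤ_[p] M}
    (s : Module.Basis.SmithNormalForm N ι n) (ha : ∀ i, s.a i ≠ 0) :
    Nonempty (pPrimaryTorsion p (M ⧸ N) ≃ₗ[ℤ_[p]]
      ((i : Fin n) → ℤ_[p] ⧸ Ideal.span {s.a i})) := by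
  classical
  let Ψ : M →ₗ[ℤ_[p]] ((i : Fin n) → ℤ_[p] ⧸ Ideal.span {s.a i}) :=
    LinearMap.pi fun i => (Submodule.mkQ (Ideal.span {s.a i})) ∘ₗ s.bM.coord (s.f i)
  have hΨ : ∀ x, Ψ x = 0 ↔ ∀ i, s.a i ∣ s.bM.repr x (s.f i) := by
    intro x
    rw [funext_iff]
    refine forall_congr' fun i => ?_
    simp only [Ψ, LinearMap.pi_apply, LinearMap.comp_apply, Submodule.mkQ_apply, Pi.zero_apply,
      Submodule.Quotient.mk_eq_zero, Ideal.mem_span_singleton, Module.Basis.coord_apply]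
  have hN : N ≤ LinearMap.ker Ψ := fun x hx => (hΨ x).2 ((s.mem_iff x).1 hx).2
  refine ⟨LinearEquiv.ofBijective ((N.liftQ Ψ hN).domRestrict _) ⟨?_, ?_⟩⟩
  · rw [← LinearMap.ker_eq_bot, eq_bot_iff]
    rintro ⟨y, k, hk⟩ hy
    obtain ⟨x, rfl⟩ := N.mkQ_surjective y
    have hy' : Ψ x = 0 := hy
    have hk' : (p : ℤ_[p]) ^ k • x ∈ N := by
      rwa [← map_smul, Submodule.mkQ_apply, Submodule.Quotient.mk_eq_zero] at hk
    have hx : x ∈ N := by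
      rw [s.mem_iff]
      refine ⟨fun j hj => ?_, (hΨ x).1 hy'⟩
      have h := ((s.mem_iff _).1 hk').1 j hj
      rw [map_smul, Finsupp.smul_apply, smul_eq_mul] at h
      exact (mul_eq_zero.1 h).resolve_left
        (pow_ne_zero _ (by exact_mod_cast (Fact.out : p.Prime).ne_zero))
    rw [Submodule.mem_bot]
    ext
    simpa using hx
  · intro c
    choose d hd using fun i => Submodule.mkQ_surjective (Ideal.span {s.a i}) (c i)
    choose k hk using fun i => PadicInt.exists_dvd_pow (ha i)
    refine ⟨⟨N.mkQ (∑ i, d i • s.bM (s.f i)), ∑ i, k i, ?_⟩, ?_⟩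
    · rw [← map_smul, Submodule.mkQ_apply, Submodule.Quotient.mk_eq_zero, Finset.smul_sum]
      refine Submodule.sum_mem _ fun i _ => ?_
      obtain ⟨e, he⟩ := (hk i).trans
        (pow_dvd_pow (p : ℤ_[p]) (Finset.single_le_sum (fun j _ => Nat.zero_le (k j))
          (Finset.mem_univ i)))
      rw [he, smul_comm, mul_comm, mul_smul, ← s.snf]
      exact N.smul_mem _ (N.smul_mem _ (s.bN i).2)
    · change Ψ (∑ i, d i • s.bM (s.f i)) = c
      ext i
      rw [← hd]
      simp only [Ψ, LinearMap.pi_apply, LinearMap.comp_apply]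
      congr 1
      simp [Finsupp.single_apply, s.f.injective.eq_iff]

theorem Module.Basis.exists_dotProduct_eq {R ι κ : Type*} [CommRing R] [Fintype ι] [DecidableEq ι]
    (b : Module.Basis κ R (ι → R)) (c : κ → R) : ∃ w : ι → R, ∀ k, w ⬝ᵥ b k = c k := by
  refine ⟨fun i => b.constr R c (Pi.single i 1), fun k => ?_⟩
  have h : ∀ v : ι → R, (fun i => b.constr R c (Pi.single i 1)) ⬝ᵥ v = b.constr R c v := by
    intro v
    conv_rhs => rw [pi_eq_sum_univ' v, map_sum]
    simp [dotProduct, mul_comm]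
  rw [h, b.constr_basis]

theorem Module.Basis.eq_of_dotProduct_eq {R ι κ : Type*} [CommRing R] [Fintype ι] [DecidableEq ι]
    (b : Module.Basis κ R (ι → R)) {v w : ι → R} (h : ∀ k, v ⬝ᵥ b k = w ⬝ᵥ b k) : v = w := by
  have : dotProductBilin R R v = dotProductBilin R R w := b.ext h
  ext i
  simpa using LinearMap.congr_fun this (Pi.single i 1)

open Matrix in
theorem nonempty_torsion_coker_equiv_coker_transpose {m n : ℕ}
    (M : Matrix (Fin m) (Fin n) ℤ_[p]) (hM : Function.Injective M.mulVec) :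
    Nonempty (pPrimaryTorsion p ((Fin m → ℤ_[p]) ⧸ LinearMap.range M.mulVecLin) ≃ₗ[ℤ_[p]]
      ((Fin n → ℤ_[p]) ⧸ LinearMap.range Mᵀ.mulVecLin)) := by
  obtain ⟨d, s⟩ := (LinearMap.range M.mulVecLin).smithNormalForm (Pi.basisFun ℤ_[p] (Fin m))
  let g := LinearEquiv.ofInjective M.mulVecLin hM
  let b : Module.Basis (Fin d) ℤ_[p] (Fin n → ℤ_[p]) := s.bN.map g.symm
  have hb : ∀ i, M *ᵥ b i = s.a i • s.bM (s.f i) := by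
    intro i
    rw [← s.snf]
    have : g (b i) = s.bN i := by simp [b]
    rw [← this]
    rfl
  have ha : ∀ i, s.a i ≠ 0 := by
    intro i h
    have := s.snf i
    rw [h, zero_smul] at this
    exact s.bN.ne_zero i (Subtype.ext this)
  obtain ⟨e⟩ := nonempty_pPrimaryTorsion_quotient_equiv s ha
  let Θ : (Fin n → ℤ_[p]) →ₗ[ℤ_[p]] ((i : Fin d) → ℤ_[p] ⧸ Ideal.span {s.a i}) :=
    LinearMap.pi fun i => (Submodule.mkQ (Ideal.span {s.a i})) ∘ₗ
      (dotProductBilin ℤ_[p] ℤ_[p]).flip (b i)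
  have hΘ : ∀ y, Θ y = 0 ↔ ∀ i, s.a i ∣ y ⬝ᵥ b i := by
    intro x
    rw [funext_iff]
    refine forall_congr' fun i => ?_
    change Submodule.mkQ (Ideal.span {s.a i}) (x ⬝ᵥ b i) = 0 ↔ _
    rw [Submodule.mkQ_apply, Submodule.Quotient.mk_eq_zero, Ideal.mem_span_singleton]
  have hdot : ∀ w i, (Mᵀ *ᵥ w) ⬝ᵥ b i = s.a i * (w ⬝ᵥ s.bM (s.f i)) := by
    intro w i
    rw [mulVec_transpose, ← dotProduct_mulVec, hb, dotProduct_smul, smul_eq_mul]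
  have hsurj : Function.Surjective Θ := by
    intro c
    choose d hd using fun i => Submodule.mkQ_surjective (Ideal.span {s.a i}) (c i)
    obtain ⟨w, hw⟩ := b.exists_dotProduct_eq d
    refine ⟨w, ?_⟩
    ext i
    rw [← hd, ← hw]
    rfl
  have hker : LinearMap.range Mᵀ.mulVecLin = LinearMap.ker Θ := by
    ext y
    rw [LinearMap.mem_ker, hΘ]
    constructor
    · rintro ⟨w, rfl⟩ i
      exact ⟨_, hdot w i⟩
    · intro h
      choose c hc using h
      classical
      obtain ⟨w, hw⟩ := s.bM.exists_dotProduct_eq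
        (fun j => if h : ∃ i, s.f i = j then c h.choose else 0)
      refine ⟨w, b.eq_of_dotProduct_eq fun i => ?_⟩
      have h' : ∃ k, s.f k = s.f i := ⟨i, rfl⟩
      rw [mulVecLin_apply, hdot, hw, hc, dif_pos h', s.f.injective h'.choose_spec]
  exact ⟨e.trans ((Submodule.quotEquivOfEq _ _ hker).trans
    (LinearMap.quotKerEquivOfSurjective Θ hsurj)).symm⟩

end SmithForm

section Reduction

variable {p : ℕ} [Fact p.Prime]

/-- Coordinatewise reduction modulo `p`. -/
noncomputable def padicReduction (p : ℕ) [Fact p.Prime] (n : ℕ) :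
    (Fin n → ℤ_[p]) →ₛₗ[(PadicInt.toZMod : ℤ_[p] →+* ZMod p)] (Fin n → ZMod p) where
  toFun v i := PadicInt.toZMod (v i)
  map_add' v w := by ext; simp
  map_smul' c v := by ext; simp

theorem padicReduction_surjective (n : ℕ) : Function.Surjective (padicReduction p n) := by
  intro s
  choose v hv using fun i => ZMod.ringHom_surjective (PadicInt.toZMod (p := p)) (s i)
  exact ⟨v, funext hv⟩

theorem padicReduction_eq_zero_iff {n : ℕ} (v : Fin n → ℤ_[p]) :
    padicReduction p n v = 0 ↔ ∃ w : Fin n → ℤ_[p], v = (p : ℤ_[p]) • w := by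
  have h : ∀ x : ℤ_[p], PadicInt.toZMod x = 0 ↔ ∃ y, x = (p : ℤ_[p]) * y := by
    intro x
    rw [← RingHom.mem_ker, PadicInt.ker_toZMod, PadicInt.maximalIdeal_eq_span_p,
      Ideal.mem_span_singleton]
    rfl
  constructor
  · intro hv
    choose w hw using fun i => (h (v i)).1 (congrFun hv i)
    exact ⟨w, funext hw⟩
  · rintro ⟨w, rfl⟩
    ext i
    exact (h _).2 ⟨w i, rfl⟩

theorem span_range_eq_top_iff_reduction {ι : Type*} {n : ℕ} (w : ι → Fin n → ℤ_[p]) :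
    Submodule.span ℤ_[p] (Set.range w) = ⊤ ↔
      Submodule.span (ZMod p) (Set.range fun i => padicReduction p n (w i)) = ⊤ := by
  have : RingHomSurjective (PadicInt.toZMod : ℤ_[p] →+* ZMod p) :=
    ⟨ZMod.ringHom_surjective _⟩
  have hmap : (Submodule.span ℤ_[p] (Set.range w)).map (padicReduction p n) =
      Submodule.span (ZMod p) (Set.range fun i => padicReduction p n (w i)) := by
    rw [Submodule.map_span, ← Set.range_comp]
    rfl
  rw [← hmap]
  constructor
  · intro h
    rw [h, Submodule.map_top, LinearMap.range_eq_top]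
    exact padicReduction_surjective n
  · intro h
    rw [eq_top_iff]
    refine Submodule.le_of_le_smul_of_le_jacobson_bot (I := IsLocalRing.maximalIdeal ℤ_[p])
      Module.Finite.fg_top (IsLocalRing.jacobson_eq_maximalIdeal ⊥ bot_ne_top).ge ?_
    intro v _
    have hv : padicReduction p n v ∈ (Submodule.span ℤ_[p] (Set.range w)).map
      (padicReduction p n) := h ▸ Submodule.mem_top
    obtain ⟨x, hx, hxv⟩ := hv
    have hz : padicReduction p n (v - x) = 0 := by rw [map_sub, hxv, sub_self]
    obtain ⟨y, hy⟩ := (padicReduction_eq_zero_iff _).1 hz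
    rw [← add_sub_cancel x v]
    refine Submodule.add_mem_sup hx ?_
    rw [hy]
    refine Submodule.smul_mem_smul ?_ Submodule.mem_top
    rw [PadicInt.maximalIdeal_eq_span_p]
    exact Ideal.mem_span_singleton_self _

open Matrix in
theorem span_range_eq_top_iff_linearIndependent_col {K : Type*} [Field K] {m n : ℕ}
    (s : Matrix (Fin m) (Fin n) K) :
    Submodule.span K (Set.range s.row) = ⊤ ↔ LinearIndependent K sᵀ.row := by
  rw [linearIndependent_iff_card_eq_finrank_span, Set.finrank, ← rank_eq_finrank_span_row,
    rank_transpose, rank_eq_finrank_span_row]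
  constructor
  · intro h
    rw [h]
    simp
  · intro h
    refine Submodule.eq_top_of_finrank_eq ?_
    rw [← h]
    simp

theorem card_spanning_tuples {m n : ℕ} (h : n ≤ m) :
    Nat.card {s : Fin m → Fin n → ZMod p // Submodule.span (ZMod p) (Set.range s) = ⊤} =
      ∏ i : Fin n, (p ^ m - p ^ (i : ℕ)) := by
  have := card_linearIndependent (K := ZMod p) (V := Fin m → ZMod p) (k := n) (by simpa using h)
  simp only [Module.finrank_fin_fun, ZMod.card] at this
  rw [← this]
  exact Nat.card_congr
    { toFun s := ⟨Matrix.transpose s.1, (span_range_eq_top_iff_linearIndependent_col s.1).1 s.2⟩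
      invFun t := ⟨Matrix.transpose t.1,
        (span_range_eq_top_iff_linearIndependent_col (Matrix.transpose t.1)).2 t.2⟩
      left_inv _ := rfl
      right_inv _ := rfl }

end Reduction

section Haar

variable {p : ℕ} [Fact p.Prime]

instance (m n : ℕ) : Measure.IsAddHaarMeasure (padicMatrixHaar p m n) := by
  unfold padicMatrixHaar
  infer_instance

instance (m n : ℕ) : IsProbabilityMeasure (padicMatrixHaar p m n) :=
  ⟨Measure.addHaarMeasure_self⟩

theorem index_map_ker_padicReduction {n : ℕ}
    (f : (Fin n → ℤ_[p]) →ₗ[ℤ_[p]] (Fin n → ℤ_[p])) (hf : Function.Injective f) :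
    ((padicReduction p n).toAddMonoidHom.ker.map f.toAddMonoidHom).index =
      p ^ n * Nat.card ((Fin n → ℤ_[p]) ⧸ LinearMap.range f) := by
  rw [AddSubgroup.index_map_of_injective _ hf, AddSubgroup.index_ker]
  congr 1
  · rw [AddMonoidHom.range_eq_top.2 (padicReduction_surjective n)]
    simp

open Pointwise in
theorem measure_rows_span_eq_range {m n : ℕ} (h : n ≤ m)
    (f : (Fin n → ℤ_[p]) →ₗ[ℤ_[p]] (Fin n → ℤ_[p])) (hf : Function.Injective f)
    [Finite ((Fin n → ℤ_[p]) ⧸ LinearMap.range f)] :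
    MeasurableSet {M : Matrix (Fin m) (Fin n) ℤ_[p] |
        Submodule.span ℤ_[p] (Set.range M.row) = LinearMap.range f} ∧
    ((p ^ n * Nat.card ((Fin n → ℤ_[p]) ⧸ LinearMap.range f) : ℕ) : ENNReal) ^ m *
      padicMatrixHaar p m n {M : Matrix (Fin m) (Fin n) ℤ_[p] |
        Submodule.span ℤ_[p] (Set.range M.row) = LinearMap.range f} =
      (∏ i : Fin n, (p ^ m - p ^ (i : ℕ)) : ℕ) := by
  set c : ℕ := p ^ n * Nat.card ((Fin n → ℤ_[p]) ⧸ LinearMap.range f) with hc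
  have hc0 : c ≠ 0 :=
    mul_ne_zero (pow_ne_zero _ (Fact.out : p.Prime).ne_zero) Nat.card_pos.ne'
  set L : AddSubgroup (Fin n → ℤ_[p]) :=
    (padicReduction p n).toAddMonoidHom.ker.map f.toAddMonoidHom with hL
  have hLmem : ∀ x, x ∈ L ↔ ∃ w, padicReduction p n w = 0 ∧ f w = x := fun x => Iff.rfl
  have hLcpt : IsCompact (L : Set (Fin n → ℤ_[p])) := by
    have : (L : Set (Fin n → ℤ_[p])) = Set.range fun w => f ((p : ℤ_[p]) • w) := by
      ext x
      rw [SetLike.mem_coe, hLmem]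
      constructor
      · rintro ⟨w, hw, rfl⟩
        obtain ⟨y, rfl⟩ := (padicReduction_eq_zero_iff w).1 hw
        exact ⟨y, rfl⟩
      · rintro ⟨y, rfl⟩
        exact ⟨_, (padicReduction_eq_zero_iff _).2 ⟨y, rfl⟩, rfl⟩
    rw [this]
    exact isCompact_range (f.continuous_on_pi.comp (continuous_const_smul _))
  let H : AddSubgroup (Matrix (Fin m) (Fin n) ℤ_[p]) :=
    AddSubgroup.pi (f := fun _ : Fin m => Fin n → ℤ_[p]) Set.univ (fun _ => L)
  have hHmem : ∀ x : Matrix (Fin m) (Fin n) ℤ_[p], x ∈ H ↔ ∀ i, x i ∈ L := by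
    have h1 : ∀ x : Fin m → Fin n → ℤ_[p],
        x ∈ AddSubgroup.pi Set.univ (fun _ => L) ↔ ∀ i, x i ∈ L := fun x => by
      simp [AddSubgroup.mem_pi]
    exact h1
  have hHidx : H.index = c ^ m := by
    have h1 := AddSubgroup.index_pi (ι := Fin m) (fun _ => L)
    have h2 : L.index = c := index_map_ker_padicReduction f hf
    rw [Finset.prod_const, h2, Finset.card_univ, Fintype.card_fin] at h1
    exact h1
  have hHmeas : MeasurableSet (H : Set (Matrix (Fin m) (Fin n) ℤ_[p])) := by
    have : (H : Set (Matrix (Fin m) (Fin n) ℤ_[p])) =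
        ⋂ i, (fun x : Matrix (Fin m) (Fin n) ℤ_[p] => x i) ⁻¹' (L : Set (Fin n → ℤ_[p])) := by
      ext x
      simp [hHmem]
    rw [this]
    exact (isClosed_iInter fun i => hLcpt.isClosed.preimage (continuous_apply i)).measurableSet
  have : H.FiniteIndex := ⟨by rw [hHidx]; exact pow_ne_zero _ hc0⟩
  have hHμ : ((c : ℕ) : ENNReal) ^ m * padicMatrixHaar p m n H = 1 := by
    have := AddSubgroup.index_mul_measure H hHmeas (padicMatrixHaar p m n)
    rw [hHidx, measure_univ] at this
    exact_mod_cast this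
  let S := {s : Fin m → Fin n → ZMod p // Submodule.span (ZMod p) (Set.range s) = ⊤}
  let r := Function.surjInv (padicReduction_surjective (p := p) n)
  have hr : ∀ x, padicReduction p n (r x) = x :=
    Function.surjInv_eq (padicReduction_surjective (p := p) n)
  let a : S → Matrix (Fin m) (Fin n) ℤ_[p] := fun s i => f (r (s.1 i))
  have hmem : ∀ s x, x ∈ (a s +ᵥ (H : Set (Matrix (Fin m) (Fin n) ℤ_[p]))) ↔
      ∃ w : Fin m → Fin n → ℤ_[p], x = (fun i => f (w i)) ∧
        (fun i => padicReduction p n (w i)) = s.1 := by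
    intro s x
    rw [Set.mem_vadd_set_iff_neg_vadd_mem, SetLike.mem_coe, hHmem]
    constructor
    · intro hx
      choose w hw0 hw using fun i => (hLmem _).1 (hx i)
      refine ⟨fun i => r (s.1 i) + w i, ?_, ?_⟩
      · funext i
        rw [map_add, hw]
        change x i = f (r (s.1 i)) + (-f (r (s.1 i)) + x i)
        abel
      · funext i
        rw [map_add, hw0, hr, add_zero]
    · rintro ⟨w, rfl, hw⟩ i
      refine (hLmem _).2 ⟨w i - r (s.1 i), ?_, ?_⟩
      · rw [map_sub, hr, ← hw, sub_self]
      · rw [map_sub]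
        change f (w i) - f (r (s.1 i)) = -f (r (s.1 i)) + f (w i)
        abel
  have hE : {M : Matrix (Fin m) (Fin n) ℤ_[p] |
      Submodule.span ℤ_[p] (Set.range M.row) = LinearMap.range f} =
      ⋃ s, (a s +ᵥ (H : Set (Matrix (Fin m) (Fin n) ℤ_[p]))) := by
    have key : ∀ w : Fin m → Fin n → ℤ_[p],
        Submodule.span ℤ_[p] (Set.range fun i => f (w i)) = LinearMap.range f ↔
          Submodule.span ℤ_[p] (Set.range w) = ⊤ := by
      intro w
      have : Submodule.span ℤ_[p] (Set.range fun i => f (w i)) =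
          (Submodule.span ℤ_[p] (Set.range w)).map f := by
        rw [Submodule.map_span, ← Set.range_comp]
        rfl
      rw [this, LinearMap.range_eq_map]
      exact (Submodule.map_injective_of_injective hf).eq_iff
    ext x
    rw [Set.mem_iUnion]
    simp only [hmem]
    constructor
    · intro hx
      have hx' : Submodule.span ℤ_[p] (Set.range x.row) = LinearMap.range f := hx
      have : ∀ i, x i ∈ LinearMap.range f := fun i => by
        rw [← hx']
        exact Submodule.subset_span ⟨i, rfl⟩
      choose w hw using this
      obtain rfl : x = fun i => f (w i) := funext fun i => (hw i).symm
      exact ⟨⟨_, (span_range_eq_top_iff_reduction w).1 ((key w).1 hx)⟩, w, rfl, rfl⟩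
    · rintro ⟨s, w, rfl, hw⟩
      refine (key w).2 ((span_range_eq_top_iff_reduction w).2 ?_)
      rw [hw]
      exact s.2
  have hmeas : ∀ s, MeasurableSet (a s +ᵥ (H : Set (Matrix (Fin m) (Fin n) ℤ_[p]))) :=
    fun s => hHmeas.const_vadd _
  have hdisj : Pairwise (Function.onFun Disjoint
      fun s => (a s +ᵥ (H : Set (Matrix (Fin m) (Fin n) ℤ_[p])))) := by
    intro s t hst
    refine Set.disjoint_left.2 fun x hx hx' => hst ?_
    obtain ⟨w, rfl, hw⟩ := (hmem s x).1 hx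
    obtain ⟨w', hww, hw'⟩ := (hmem t _).1 hx'
    have : w = w' := funext fun i => hf (congrFun hww i)
    exact Subtype.ext (hw ▸ this ▸ hw')
  rw [hE]
  refine ⟨MeasurableSet.iUnion hmeas, ?_⟩
  rw [measure_iUnion hdisj hmeas]
  simp only [measure_vadd]
  rw [ENNReal.tsum_const, mul_left_comm, hHμ, mul_one, ← card_spanning_tuples h,
    ENat.card_eq_coe_natCard]
  rfl

end Haar

section Injective

variable {p : ℕ} [Fact p.Prime]

open Matrix in
theorem card_filter_det_add_smul_one_le {R : Type*} [CommRing R] [IsDomain R] [CharZero R]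
    [DecidableEq R] {n : ℕ} (A : Matrix (Fin n) (Fin n) R) (K : ℕ) :
    ((Finset.range K).filter fun t : ℕ => (A + (t : R) • 1).det = 0).card ≤ n := by
  calc _ ≤ (-A).charpoly.roots.toFinset.card := by
        refine Finset.card_le_card_of_injOn (fun t : ℕ => (t : R)) ?_ Nat.cast_injective.injOn
        intro t ht
        have ht' := (Finset.mem_filter.1 ht).2
        rw [Finset.mem_coe, Multiset.mem_toFinset,
          Polynomial.mem_roots (charpoly_monic _).ne_zero, Polynomial.IsRoot, eval_charpoly,
          ← ht', sub_neg_eq_add, add_comm, smul_one_eq_diagonal, scalar_apply]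
    _ ≤ (-A).charpoly.roots.card := Multiset.toFinset_card_le _
    _ ≤ (-A).charpoly.natDegree := Polynomial.card_roots' _
    _ = n := by rw [charpoly_natDegree_eq_dim, Fintype.card_fin]

open Matrix in
theorem measure_minor_det_eq_zero (n u : ℕ) :
    padicMatrixHaar p (n + u) n
      {M | (M.submatrix (Fin.castAdd u) id).det = 0} = 0 := by
  classical
  set μ := padicMatrixHaar p (n + u) n
  set S : Set (Matrix (Fin (n + u)) (Fin n) ℤ_[p]) :=
    {M | (M.submatrix (Fin.castAdd u) id).det = 0}
  have hS : MeasurableSet S := by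
    refine (isClosed_singleton.preimage (Continuous.matrix_det
      (continuous_id.matrix_submatrix _ _)) : IsClosed S).measurableSet
  let E : Matrix (Fin (n + u)) (Fin n) ℤ_[p] :=
    Matrix.of fun i j => if i = Fin.castAdd u j then 1 else 0
  have hE : E.submatrix (Fin.castAdd u) id = 1 := by
    ext i j
    simp [E, Matrix.one_apply]
  let T : ℕ → Set (Matrix (Fin (n + u)) (Fin n) ℤ_[p]) :=
    fun t => (fun M => M + (t : ℤ_[p]) • E) ⁻¹' S
  have hT : ∀ t, MeasurableSet (T t) := fun t => (measurable_add_const _) hS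
  have hTμ : ∀ t, μ (T t) = μ S := fun t => measure_preimage_add_right μ _ S
  by_contra h0
  obtain ⟨K, hK⟩ := ENNReal.exists_nat_mul_gt h0 (ENNReal.natCast_ne_top n)
  refine hK.not_ge ?_
  calc (K : ENNReal) * μ S = ∑ t ∈ Finset.range K, μ (T t) := by
        simp [hTμ]
    _ = ∑ t ∈ Finset.range K, ∫⁻ M, (T t).indicator 1 M ∂μ := by
        simp [hT]
    _ = ∫⁻ M, ∑ t ∈ Finset.range K, (T t).indicator 1 M ∂μ := by
        rw [lintegral_finsetSum]
        exact fun t _ => measurable_one.indicator (hT t)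
    _ ≤ ∫⁻ _, (n : ENNReal) ∂μ := by
        refine lintegral_mono fun M => ?_
        have h := card_filter_det_add_smul_one_le (M.submatrix (Fin.castAdd u) id) K
        have h1 : ∀ t : ℕ, M ∈ T t ↔
            (M.submatrix (Fin.castAdd u) id + (t : ℤ_[p]) • 1).det = 0 := by
          intro t
          rw [← hE]
          rfl
        simp only [Set.indicator_apply, h1, Pi.one_apply, Finset.sum_boole]
        exact_mod_cast h
    _ = n := by simp

open Matrix in
theorem ae_injective_mulVec (n u : ℕ) :
    ∀ᵐ M ∂padicMatrixHaar p (n + u) n, Function.Injective M.mulVec := by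
  rw [ae_iff]
  refine measure_mono_null (fun M hM => ?_) (measure_minor_det_eq_zero n u)
  by_contra hdet
  refine hM ?_
  intro v w hvw
  refine mulVec_injective_of_det_ne_zero hdet ?_
  ext i
  exact congrFun hvw (Fin.castAdd u i)

end Injective

section Surjections

variable {p : ℕ} [Fact p.Prime] {G : Type} [AddCommGroup G] [Module ℤ_[p] G]

theorem AddMonoidHom.map_padicInt_smul {k : ℕ} (hk : Nat.card G = p ^ k) (φ : G →+ G)
    (c : ℤ_[p]) (x : G) : φ (c • x) = c • φ x := by
  have h0 : ∀ y : G, (p : ℤ_[p]) ^ k • y = 0 := fun y => by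
    have := card_nsmul_eq_zero' (x := y)
    rw [hk, ← Nat.cast_smul_eq_nsmul ℤ_[p]] at this
    exact_mod_cast this
  obtain ⟨d, hd⟩ := Ideal.mem_span_singleton.1 (PadicInt.appr_spec k c)
  have h1 : ∀ y : G, c • y = c.appr k • y := fun y => by
    rw [← Nat.cast_smul_eq_nsmul ℤ_[p], ← sub_eq_zero, ← sub_smul, hd, mul_comm, mul_smul, h0,
      smul_zero]
  rw [h1, h1, map_nsmul]

theorem card_linearEquiv_eq_card_addEquiv (hG : ∃ k : ℕ, Nat.card G = p ^ k) :
    Nat.card (G ≃ₗ[ℤ_[p]] G) = Nat.card (G ≃+ G) := by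
  obtain ⟨k, hk⟩ := hG
  exact Nat.card_congr
    { toFun e := e.toAddEquiv
      invFun e := e.toLinearEquiv fun c x => e.toAddMonoidHom.map_padicInt_smul hk c x
      left_inv _ := rfl
      right_inv _ := rfl }

/-- Surjections onto `G` with a prescribed kernel form a torsor under the automorphisms
of `G`. -/
theorem card_surjections_with_ker {R V G : Type*} [CommRing R] [AddCommGroup V] [Module R V]
    [AddCommGroup G] [Module R G] {L : Submodule R V} (e : (V ⧸ L) ≃ₗ[R] G) :
    Nat.card {φ : {φ : V →ₗ[R] G // Function.Surjective φ} // L = LinearMap.ker φ.1} =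
      Nat.card (G ≃ₗ[R] G) := by
  symm
  exact Nat.card_congr
    { toFun σ := ⟨⟨(e.trans σ).toLinearMap ∘ₗ L.mkQ,
        (e.trans σ).surjective.comp L.mkQ_surjective⟩, by
          rw [LinearEquiv.ker_comp, Submodule.ker_mkQ]⟩
      invFun φ := e.symm.trans ((Submodule.quotEquivOfEq _ _ φ.2).trans
        (LinearMap.quotKerEquivOfSurjective φ.1.1 φ.1.2))
      left_inv σ := by
        ext x
        obtain ⟨v, hv⟩ := L.mkQ_surjective (e.symm x)
        obtain rfl : x = e (L.mkQ v) := by rw [hv, LinearEquiv.apply_symm_apply]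
        simp
      right_inv φ := by
        ext x
        simp }

instance [Finite G] (n : ℕ) : Finite ((Fin n → ℤ_[p]) →ₗ[ℤ_[p]] G) :=
  Finite.of_equiv _ ((Pi.basisFun ℤ_[p] (Fin n)).constr ℤ_[p] (M' := G)).toEquiv

theorem card_surjections_le {n : ℕ} [Finite G] :
    Nat.card {φ : (Fin n → ℤ_[p]) →ₗ[ℤ_[p]] G // Function.Surjective φ} ≤ Nat.card G ^ n := by
  have e := (Pi.basisFun ℤ_[p] (Fin n)).constr ℤ_[p] (M' := G)
  refine (Finite.card_subtype_le _).trans ?_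
  rw [← Nat.card_congr e.toEquiv, Nat.card_fun, Nat.card_fin]

theorem card_pow_le_card_surjections_add {n : ℕ} [Finite G]
    [Fintype {H : Submodule ℤ_[p] G // H ≠ ⊤}] :
    Nat.card G ^ n ≤
      Nat.card {φ : (Fin n → ℤ_[p]) →ₗ[ℤ_[p]] G // Function.Surjective φ} +
        ∑ H : {H : Submodule ℤ_[p] G // H ≠ ⊤}, Nat.card H.1 ^ n := by
  classical
  have e := (Pi.basisFun ℤ_[p] (Fin n)).constr ℤ_[p] (M' := G)
  have h1 : Nat.card G ^ n = Nat.card ((Fin n → ℤ_[p]) →ₗ[ℤ_[p]] G) := by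
    rw [← Nat.card_congr e.toEquiv, Nat.card_fun, Nat.card_fin]
  have h2 : ∑ H : {H : Submodule ℤ_[p] G // H ≠ ⊤}, Nat.card H.1 ^ n =
      Nat.card ((H : {H : Submodule ℤ_[p] G // H ≠ ⊤}) × (Fin n → H.1)) := by
    simp [Nat.card_sigma, Nat.card_fun]
  rw [h1, h2, ← Nat.card_congr (Equiv.sumCompl fun φ : (Fin n → ℤ_[p]) →ₗ[ℤ_[p]] G =>
    Function.Surjective φ), Nat.card_sum]
  gcongr
  refine Nat.card_le_card_of_injective
    (fun φ => ⟨⟨LinearMap.range φ.1, fun h => φ.2 (LinearMap.range_eq_top.1 h)⟩,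
      fun i => ⟨φ.1 (Pi.single i 1), ⟨_, rfl⟩⟩⟩) ?_
  intro φ ψ h
  have h' := congrArg (fun x : (H : {H : Submodule ℤ_[p] G // H ≠ ⊤}) × (Fin n → H.1) =>
    fun i => ((x.2 i : x.1.1) : G)) h
  refine Subtype.ext ((Pi.basisFun ℤ_[p] (Fin n)).ext fun i => ?_)
  simpa using congrFun h' i

theorem tendsto_card_surjections_div [Finite G] :
    Tendsto (fun n : ℕ =>
      (Nat.card {φ : (Fin n → ℤ_[p]) →ₗ[ℤ_[p]] G // Function.Surjective φ} : ℝ) /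
        (Nat.card G : ℝ) ^ n) atTop (nhds 1) := by
  classical
  have := Fintype.ofFinite {H : Submodule ℤ_[p] G // H ≠ ⊤}
  have hpos : (0 : ℝ) < Nat.card G := by exact_mod_cast Nat.card_pos
  have hlim : Tendsto (fun n : ℕ => 1 - ∑ H : {H : Submodule ℤ_[p] G // H ≠ ⊤},
      ((Nat.card H.1 : ℝ) / Nat.card G) ^ n) atTop (nhds (1 - ∑ H :
        {H : Submodule ℤ_[p] G // H ≠ ⊤}, 0)) := by
    refine tendsto_const_nhds.sub (tendsto_finsetSum _ fun H _ => ?_)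
    refine tendsto_pow_atTop_nhds_zero_of_lt_one (by positivity) ?_
    rw [div_lt_one hpos]
    have hlt : Nat.card H.1 < Nat.card G := by
      have := Set.ncard_lt_ncard (s := (H.1 : Set G)) (t := Set.univ)
        (Set.ssubset_univ_iff.2 fun h => H.2 (SetLike.coe_injective h))
      rwa [Set.ncard_univ] at this
    exact_mod_cast hlt
  rw [Finset.sum_const_zero, sub_zero] at hlim
  refine tendsto_of_tendsto_of_tendsto_of_le_of_le hlim tendsto_const_nhds (fun n => ?_)
    (fun n => ?_)
  · have h : (Nat.card G : ℝ) ^ n ≤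
        Nat.card {φ : (Fin n → ℤ_[p]) →ₗ[ℤ_[p]] G // Function.Surjective φ} +
          ∑ H : {H : Submodule ℤ_[p] G // H ≠ ⊤}, (Nat.card H.1 : ℝ) ^ n := by
      exact_mod_cast card_pow_le_card_surjections_add (p := p) (G := G) (n := n)
    simp only [div_pow]
    rw [← Finset.sum_div, le_div_iff₀ (by positivity), sub_mul, one_mul,
      div_mul_cancel₀ _ (by positivity)]
    linarith
  · have h : (Nat.card {φ : (Fin n → ℤ_[p]) →ₗ[ℤ_[p]] G // Function.Surjective φ} : ℝ) ≤
        (Nat.card G : ℝ) ^ n := by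
      exact_mod_cast card_surjections_le (p := p) (G := G) (n := n)
    exact div_le_one_of_le₀ h (by positivity)

end Surjections

section Distribution

variable {p : ℕ} [Fact p.Prime]

theorem exists_injective_range_eq_of_finite_quotient {n : ℕ}
    (L : Submodule ℤ_[p] (Fin n → ℤ_[p])) [Finite ((Fin n → ℤ_[p]) ⧸ L)] :
    ∃ f : (Fin n → ℤ_[p]) →ₗ[ℤ_[p]] (Fin n → ℤ_[p]),
      Function.Injective f ∧ LinearMap.range f = L := by
  set N := Nat.card ((Fin n → ℤ_[p]) ⧸ L)
  have hN : (N : ℤ_[p]) ≠ 0 := Nat.cast_ne_zero.2 Nat.card_pos.ne'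
  have hmem : ∀ v : Fin n → ℤ_[p], (N : ℤ_[p]) • v ∈ L := fun v => by
    rw [← Submodule.Quotient.mk_eq_zero, Submodule.Quotient.mk_smul, Nat.cast_smul_eq_nsmul]
    exact card_nsmul_eq_zero'
  let g : (Fin n → ℤ_[p]) →ₗ[ℤ_[p]] L :=
    ((N : ℤ_[p]) • LinearMap.id).codRestrict L hmem
  have hg : Function.Injective g := fun v w h =>
    smul_right_injective _ hN (congrArg Subtype.val h)
  have hfin : Module.finrank ℤ_[p] (Fin n → ℤ_[p]) = Module.finrank ℤ_[p] L :=
    le_antisymm (LinearMap.finrank_le_finrank_of_injective hg) (Submodule.finrank_le L)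
  let e := LinearEquiv.ofFinrankEq (Fin n → ℤ_[p]) L hfin
  refine ⟨L.subtype ∘ₗ e.toLinearMap, L.injective_subtype.comp e.injective, ?_⟩
  rw [LinearMap.range_comp, LinearEquiv.range, Submodule.map_top, Submodule.range_subtype]

theorem range_transpose_mulVecLin_eq_span_row {R : Type*} [CommRing R] {m n : ℕ}
    (M : Matrix (Fin m) (Fin n) R) :
    LinearMap.range (Matrix.transpose M).mulVecLin = Submodule.span R (Set.range M.row) := by
  rw [Matrix.range_mulVecLin, Matrix.col_transpose]

variable {G : Type} [AddCommGroup G] [Module ℤ_[p] G] [Finite G]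

theorem measure_rows_span_eq_ker {m n : ℕ} (h : n ≤ m)
    (φ : (Fin n → ℤ_[p]) →ₗ[ℤ_[p]] G) (hφ : Function.Surjective φ) :
    MeasurableSet {M : Matrix (Fin m) (Fin n) ℤ_[p] |
        Submodule.span ℤ_[p] (Set.range M.row) = LinearMap.ker φ} ∧
    ((p ^ n * Nat.card G : ℕ) : ENNReal) ^ m *
      padicMatrixHaar p m n {M : Matrix (Fin m) (Fin n) ℤ_[p] |
        Submodule.span ℤ_[p] (Set.range M.row) = LinearMap.ker φ} =
      (∏ i : Fin n, (p ^ m - p ^ (i : ℕ)) : ℕ) := by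
  have e := LinearMap.quotKerEquivOfSurjective φ hφ
  have : Finite ((Fin n → ℤ_[p]) ⧸ LinearMap.ker φ) := Finite.of_equiv _ e.toEquiv.symm
  rw [← Nat.card_congr e.toEquiv]
  obtain ⟨f, hf, hfr⟩ := exists_injective_range_eq_of_finite_quotient (LinearMap.ker φ)
  rw [← hfr] at this ⊢
  exact measure_rows_span_eq_range h f hf

theorem card_mul_measure_coker_transpose_eq {m n : ℕ} (h : n ≤ m) :
    (Nat.card (G ≃ₗ[ℤ_[p]] G) : ENNReal) * (((p ^ n * Nat.card G : ℕ) : ENNReal) ^ m *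
      padicMatrixHaar p m n {M : Matrix (Fin m) (Fin n) ℤ_[p] |
        Nonempty (((Fin n → ℤ_[p]) ⧸ LinearMap.range (Matrix.transpose M).mulVecLin)
          ≃ₗ[ℤ_[p]] G)}) =
      Nat.card {φ : (Fin n → ℤ_[p]) →ₗ[ℤ_[p]] G // Function.Surjective φ} *
        (∏ i : Fin n, (p ^ m - p ^ (i : ℕ)) : ℕ) := by
  classical
  set μ := padicMatrixHaar p m n
  let Sur := {φ : (Fin n → ℤ_[p]) →ₗ[ℤ_[p]] G // Function.Surjective φ}
  let E : Sur → Set (Matrix (Fin m) (Fin n) ℤ_[p]) := fun φ =>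
    {M | Submodule.span ℤ_[p] (Set.range M.row) = LinearMap.ker φ.1}
  have hE : ∀ φ, MeasurableSet (E φ) := fun φ => (measure_rows_span_eq_ker h φ.1 φ.2).1
  set F : Set (Matrix (Fin m) (Fin n) ℤ_[p]) := {M |
    Nonempty (((Fin n → ℤ_[p]) ⧸ LinearMap.range (Matrix.transpose M).mulVecLin)
      ≃ₗ[ℤ_[p]] G)} with hFdef
  have hFE : F = ⋃ φ, E φ := by
    ext M
    rw [Set.mem_iUnion, hFdef, Set.mem_ofPred_eq, range_transpose_mulVecLin_eq_span_row]
    constructor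
    · rintro ⟨e⟩
      refine ⟨⟨e.toLinearMap ∘ₗ Submodule.mkQ _, e.surjective.comp (Submodule.mkQ_surjective _)⟩,
        ?_⟩
      change _ = LinearMap.ker (e.toLinearMap ∘ₗ Submodule.mkQ _)
      rw [LinearEquiv.ker_comp, Submodule.ker_mkQ]
    · rintro ⟨φ, hφ⟩
      exact ⟨(Submodule.quotEquivOfEq _ _ hφ).trans
        (LinearMap.quotKerEquivOfSurjective φ.1 φ.2)⟩
  have := Fintype.ofFinite Sur
  have hF : MeasurableSet F := hFE ▸ MeasurableSet.iUnion hE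
  have hcount : ∀ M, ∑ φ, (E φ).indicator (1 : Matrix (Fin m) (Fin n) ℤ_[p] → ENNReal) M =
      F.indicator (fun _ => (Nat.card (G ≃ₗ[ℤ_[p]] G) : ENNReal)) M := by
    intro M
    by_cases hM : M ∈ F
    · rw [Set.indicator_of_mem hM]
      obtain ⟨e⟩ := hM
      rw [range_transpose_mulVecLin_eq_span_row] at e
      rw [← card_surjections_with_ker e]
      have hmem : ∀ φ, M ∈ E φ ↔
          Submodule.span ℤ_[p] (Set.range M.row) = LinearMap.ker φ.1 := fun _ => Iff.rfl
      simp only [Set.indicator_apply, hmem, Pi.one_apply, Finset.sum_boole]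
      rw [Nat.card_eq_fintype_card, Fintype.card_subtype]
    · rw [Set.indicator_of_notMem hM]
      refine Finset.sum_eq_zero fun φ _ => Set.indicator_of_notMem (fun hφ => hM ?_) _
      rw [hFE]
      exact Set.mem_iUnion.2 ⟨φ, hφ⟩
  have hsum : (Nat.card (G ≃ₗ[ℤ_[p]] G) : ENNReal) * μ F = ∑ φ, μ (E φ) := by
    rw [← lintegral_indicator_const hF, ← lintegral_congr hcount, lintegral_finsetSum]
    · simp [hE]
    · exact fun φ _ => measurable_one.indicator (hE φ)
  rw [mul_left_comm, hsum, Finset.mul_sum,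
    Finset.sum_congr rfl fun φ _ => (measure_rows_span_eq_ker h φ.1 φ.2).2, Finset.sum_const,
    nsmul_eq_mul, Finset.card_univ, Nat.card_eq_fintype_card]

theorem prod_pow_sub_pow_div {q : ℝ} (hq : q ≠ 0) (n u : ℕ) :
    (∏ i ∈ Finset.range n, (q ^ (n + u) - q ^ i)) / (q ^ n) ^ (n + u) =
      ∏ i ∈ Finset.range n, (1 - (q ^ (i + 1 + u))⁻¹) := by
  have h : (q ^ n) ^ (n + u) = ∏ _i ∈ Finset.range n, q ^ (n + u) := by
    rw [Finset.prod_const, Finset.card_range, ← pow_mul, ← pow_mul, mul_comm]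
  rw [h, ← Finset.prod_div_distrib, ← Finset.prod_range_reflect]
  refine Finset.prod_congr rfl fun i hi => ?_
  have hi' := Finset.mem_range.1 hi
  rw [sub_div, div_self (pow_ne_zero _ hq),
    show n + u = (n - 1 - i) + (i + 1 + u) by omega, pow_add, div_mul_cancel_left₀
      (pow_ne_zero _ hq)]

theorem toReal_measure_torsion_coker_eq (hG : ∃ k : ℕ, Nat.card G = p ^ k) (n u : ℕ) :
    (padicMatrixHaar p (n + u) n
      {M : Matrix (Fin (n + u)) (Fin n) ℤ_[p] |
        Nonempty
          ((pPrimaryTorsion p ((Fin (n + u) → ℤ_[p]) ⧸ LinearMap.range M.mulVecLin))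
            ≃ₗ[ℤ_[p]] G)}).toReal =
      (Nat.card {φ : (Fin n → ℤ_[p]) →ₗ[ℤ_[p]] G // Function.Surjective φ} : ℝ) /
        (Nat.card G : ℝ) ^ n *
        ((∏ i ∈ Finset.range n, (1 - ((p : ℝ) ^ (i + 1 + u))⁻¹)) /
          ((Nat.card G : ℝ) ^ u * (Nat.card (G ≃+ G) : ℝ))) := by
  have hae : ({M : Matrix (Fin (n + u)) (Fin n) ℤ_[p] |
        Nonempty
          ((pPrimaryTorsion p ((Fin (n + u) → ℤ_[p]) ⧸ LinearMap.range M.mulVecLin))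
            ≃ₗ[ℤ_[p]] G)} : Set _) =ᵐ[padicMatrixHaar p (n + u) n]
      {M : Matrix (Fin (n + u)) (Fin n) ℤ_[p] |
        Nonempty (((Fin n → ℤ_[p]) ⧸ LinearMap.range (Matrix.transpose M).mulVecLin)
          ≃ₗ[ℤ_[p]] G)} := by
    filter_upwards [ae_injective_mulVec n u] with M hM
    obtain ⟨e⟩ := nonempty_torsion_coker_equiv_coker_transpose M hM
    exact propext ⟨fun ⟨f⟩ => ⟨e.symm.trans f⟩, fun ⟨f⟩ => ⟨e.trans f⟩⟩
  rw [measure_congr hae]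
  have h := congrArg ENNReal.toReal
    (card_mul_measure_coker_transpose_eq (p := p) (G := G) (Nat.le_add_right n u))
  have hp : (p : ℝ) ≠ 0 := Nat.cast_ne_zero.2 (Fact.out : p.Prime).ne_zero
  have hprod : ((∏ i : Fin n, (p ^ (n + u) - p ^ (i : ℕ)) : ℕ) : ℝ) =
      ∏ i ∈ Finset.range n, ((p : ℝ) ^ (n + u) - (p : ℝ) ^ i) := by
    rw [Finset.prod_range, Nat.cast_prod]
    refine Finset.prod_congr rfl fun i _ => ?_
    rw [Nat.cast_sub (Nat.pow_le_pow_right (Fact.out : p.Prime).pos (by omega))]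
    push_cast
    rfl
  simp only [ENNReal.toReal_mul, ENNReal.toReal_pow, ENNReal.toReal_natCast] at h
  rw [card_linearEquiv_eq_card_addEquiv hG, hprod] at h
  have hGpos : (Nat.card G : ℝ) ≠ 0 := Nat.cast_ne_zero.2 Nat.card_pos.ne'
  have hAut : (Nat.card (G ≃+ G) : ℝ) ≠ 0 := Nat.cast_ne_zero.2 Nat.card_pos.ne'
  rw [← prod_pow_sub_pow_div hp]
  push_cast at h
  field_simp
  rw [mul_pow] at h
  linear_combination h

theorem tendsto_prod_one_sub_inv_pow (u : ℕ) :
    Tendsto (fun n => ∏ i ∈ Finset.range n, (1 - ((p : ℝ) ^ (i + 1 + u))⁻¹)) atTop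
      (nhds (∏' i : ℕ, (1 - ((p : ℝ) ^ (i + 1 + u))⁻¹))) := by
  have hp : (1 : ℝ) < p := by exact_mod_cast (Fact.out : p.Prime).one_lt
  have hsum : Summable fun i : ℕ => -((p : ℝ) ^ (i + 1 + u))⁻¹ := by
    have := (summable_nat_add_iff (1 + u)).2
      (summable_geometric_of_lt_one (by positivity) (inv_lt_one_of_one_lt₀ hp))
    simpa only [inv_pow, add_assoc] using this.neg
  have h := (Real.multipliable_one_add_of_summable hsum).hasProd.tendsto_prod_nat
  simpa only [← sub_eq_add_neg] using h

end Distribution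

theorem torsion_cokernel_distribution (p : ℕ) [Fact p.Prime] (u : ℕ)
    (G : Type) [AddCommGroup G] [Module ℤ_[p] G] [Finite G]
    (hG : ∃ k : ℕ, Nat.card G = p ^ k) :
    Tendsto
      (fun n : ℕ =>
        (padicMatrixHaar p (n + u) n
          {M : Matrix (Fin (n + u)) (Fin n) ℤ_[p] |
            Nonempty
              ((pPrimaryTorsion p ((Fin (n + u) → ℤ_[p]) ⧸ LinearMap.range M.mulVecLin))
                ≃ₗ[ℤ_[p]] G)}).toReal)
      atTop
      (nhds ((∏' i : ℕ, (1 - ((p : ℝ) ^ (i + 1 + u))⁻¹)) /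
        ((Nat.card G : ℝ) ^ u * (Nat.card (G ≃+ G) : ℝ)))) := by
  simp only [toReal_measure_torsion_coker_eq hG]
  simpa only [one_mul] using (tendsto_card_surjections_div (p := p) (G := G)).mul
    ((tendsto_prod_one_sub_inv_pow (p := p) u).div_const _)
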